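/- Let T_ρ = {D_{P_1}, D_{P_2}, D_{S_1}, ρ(D_{S_1}), D_{S_2}, ρ(D_{S_2})} be a ρ-symmetric cluster configuration of the heptagon Π, consisting of two paired diagonals and two ρ-orbits of single diagonals, and for D ∈ T_ρ let D* denote its unique complement. Then for k ∈ {1,2} the set (T_ρ \ {D_{P_k}}) ∪ {D_{P_k}*} is again a ρ-symmetric cluster configuration (with D_{P_k}* paired), and for l ∈ {1,2} the set (T_ρ \ {D_{S_l}, ρ(D_{S_l})}) ∪ {D_{S_l}*, ρ(D_{S_l}*)} is again a ρ-symmetric cluster configuration (with D_{S_l}* single and ρ(D_{S_l})* = ρ(D_{S_l}*)). In particular, paired diagonals are exchanged with paired diagonals and single diagonals with single diagonals. -/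

import Mathlib

/-!
The combinatorial model of the cluster category `C_{E₆}` by coloured oriented
single and paired diagonals of a regular heptagon, following L. Lamberti,
"Combinatorial model for the cluster categories of type E", Section 5.

The vertices of the heptagon `Π` are labelled by `ZMod 7` (clockwise; the
label `7` is the same as `0`).  `Π_{1,2,2}` consists of the 42 diagonals
`[i,i+2]_P, [i,i+3]_P, [i,i+4]_R, [i,i+5]_R, [i+4,i]_B, [i+5,i]_B`.
-/

inductive Colour : Type
  | R : Colour
  | B : Colour
  | P : Colour
deriving DecidableEq

/-- A coloured oriented (single or paired) diagonal `[i,j]_c` of the regular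
heptagon. -/
structure Dg where
  i : ZMod 7
  j : ZMod 7
  c : Colour
deriving DecidableEq

/-- Abbreviation for entering diagonals by natural-number labels. -/
def dg (a b : ℕ) (c : Colour) : Dg := ⟨(a : ZMod 7), (b : ZMod 7), c⟩

/-- `ρ`: simultaneous change of colour and orientation. -/
def rho : Dg → Dg
  | ⟨i, j, Colour.R⟩ => ⟨j, i, Colour.B⟩
  | ⟨i, j, Colour.B⟩ => ⟨j, i, Colour.R⟩
  | ⟨i, j, Colour.P⟩ => ⟨i, j, Colour.P⟩

/-- The rotation `[i,j]_c ↦ [i-1,j-1]_c`. -/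
def shiftD (d : Dg) : Dg := ⟨d.i - 1, d.j - 1, d.c⟩

/-- The 42 coloured oriented single and paired diagonals `Π_{1,2,2}` of the
heptagon. -/
def InPi (d : Dg) : Prop :=
  ∃ i : ZMod 7, d = ⟨i, i + 2, Colour.P⟩ ∨ d = ⟨i, i + 3, Colour.P⟩ ∨
    d = ⟨i, i + 4, Colour.R⟩ ∨ d = ⟨i, i + 5, Colour.R⟩ ∨
    d = ⟨i + 4, i, Colour.B⟩ ∨ d = ⟨i + 5, i, Colour.B⟩

/-- The first slice `Π_{1,2,2}|_1` of the quiver `Γ := Γ^7_{1,2,2}`. -/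
def firstSlice : List Dg :=
  [dg 1 3 Colour.P, dg 1 4 Colour.P, dg 1 5 Colour.R, dg 1 6 Colour.R,
   dg 5 1 Colour.B, dg 6 1 Colour.B]

/-- The translation `τ` of `Γ^7_{1,2,2}`: the rotation `[i,j]_c ↦ [i-1,j-1]_c`
composed with the colour-orientation swap `ρ` on the first slice. -/
def tau7 (d : Dg) : Dg :=
  if d ∈ firstSlice then rho (shiftD d) else shiftD d

/-- The translation applied to a whole collection of diagonals. -/
def tauT (T : Finset Dg) : Finset Dg := T.image tau7

/-- The curves of `(1, 3, 'P')`. -/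
def c13 : List (List Dg) :=
  [  [dg 2 4 Colour.P,
   dg 2 5 Colour.P,
   dg 2 6 Colour.R,
   dg 6 2 Colour.B,
   dg 2 7 Colour.R,
   dg 7 2 Colour.B,
   dg 3 7 Colour.R,
   dg 7 3 Colour.B,
   dg 4 7 Colour.P,
   dg 5 7 Colour.P,
   dg 5 1 Colour.P],
  [dg 7 2 Colour.P,
   dg 6 2 Colour.P,
   dg 5 2 Colour.R,
   dg 2 5 Colour.B,
   dg 4 2 Colour.R,
   dg 2 4 Colour.B,
   dg 4 1 Colour.R,
   dg 1 4 Colour.B,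
   dg 4 7 Colour.P,
   dg 4 6 Colour.P,
   dg 3 6 Colour.P]]

/-- The curves of `(1, 4, 'P')`. -/
def c14 : List (List Dg) :=
  [  [dg 2 5 Colour.P,
   dg 2 6 Colour.R,
   dg 6 2 Colour.B,
   dg 2 7 Colour.R,
   dg 7 2 Colour.B,
   dg 3 7 Colour.R,
   dg 7 3 Colour.B,
   dg 4 7 Colour.P,
   dg 5 7 Colour.P,
   dg 5 1 Colour.P],
  [dg 3 5 Colour.P,
   dg 3 6 Colour.P,
   dg 3 7 Colour.R,
   dg 7 3 Colour.B,
   dg 3 1 Colour.R,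
   dg 1 3 Colour.B,
   dg 4 1 Colour.R,
   dg 1 4 Colour.B,
   dg 5 1 Colour.P,
   dg 6 1 Colour.P,
   dg 6 2 Colour.P],
  [dg 7 3 Colour.P,
   dg 7 2 Colour.P,
   dg 6 2 Colour.P,
   dg 5 2 Colour.R,
   dg 2 5 Colour.B,
   dg 4 2 Colour.R,
   dg 2 4 Colour.B,
   dg 4 1 Colour.R,
   dg 1 4 Colour.B,
   dg 4 7 Colour.P],
  [dg 3 6 Colour.P,
   dg 4 6 Colour.P,
   dg 4 7 Colour.P,
   dg 5 7 Colour.P,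
   dg 5 1 Colour.P,
   dg 5 2 Colour.R,
   dg 5 3 Colour.R,
   dg 2 5 Colour.B,
   dg 3 5 Colour.B,
   dg 6 3 Colour.R,
   dg 3 6 Colour.B]]

/-- The curves of `(1, 5, 'R')`. -/
def c15 : List (List Dg) :=
  [  [dg 2 6 Colour.R,
   dg 3 6 Colour.P,
   dg 4 6 Colour.P,
   dg 4 7 Colour.P,
   dg 4 1 Colour.R,
   dg 4 2 Colour.R,
   dg 5 2 Colour.R],
  [dg 2 7 Colour.R,
   dg 3 7 Colour.R,
   dg 4 7 Colour.P,
   dg 5 7 Colour.P,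
   dg 5 1 Colour.P,
   dg 5 2 Colour.R,
   dg 5 3 Colour.R,
   dg 6 3 Colour.R],
  [dg 4 7 Colour.B,
   dg 7 3 Colour.P,
   dg 7 2 Colour.P,
   dg 6 2 Colour.P,
   dg 2 5 Colour.B,
   dg 2 4 Colour.B,
   dg 1 4 Colour.B],
  [dg 7 3 Colour.B,
   dg 1 3 Colour.B,
   dg 1 4 Colour.B,
   dg 5 1 Colour.P,
   dg 6 1 Colour.P,
   dg 6 2 Colour.P,
   dg 3 6 Colour.B,
   dg 4 6 Colour.B]]

/-- The curves of `(1, 6, 'R')`. -/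
def c16 : List (List Dg) :=
  [  [dg 2 7 Colour.R,
   dg 3 7 Colour.R,
   dg 4 7 Colour.P,
   dg 5 7 Colour.P,
   dg 5 1 Colour.P,
   dg 5 2 Colour.R,
   dg 5 3 Colour.R,
   dg 6 3 Colour.R],
  [dg 5 7 Colour.B,
   dg 4 7 Colour.B,
   dg 7 3 Colour.P,
   dg 7 2 Colour.P,
   dg 6 2 Colour.P,
   dg 2 5 Colour.B,
   dg 2 4 Colour.B,
   dg 1 4 Colour.B]]

/-- The curves of `(5, 1, 'B')`. -/
def c51 : List (List Dg) :=
  [  [dg 6 2 Colour.B,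
   dg 3 6 Colour.P,
   dg 4 6 Colour.P,
   dg 4 7 Colour.P,
   dg 1 4 Colour.B,
   dg 2 4 Colour.B,
   dg 2 5 Colour.B],
  [dg 7 2 Colour.B,
   dg 7 3 Colour.B,
   dg 4 7 Colour.P,
   dg 5 7 Colour.P,
   dg 5 1 Colour.P,
   dg 2 5 Colour.B,
   dg 3 5 Colour.B,
   dg 3 6 Colour.B],
  [dg 7 4 Colour.R,
   dg 7 3 Colour.P,
   dg 7 2 Colour.P,
   dg 6 2 Colour.P,
   dg 5 2 Colour.R,
   dg 4 2 Colour.R,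
   dg 4 1 Colour.R],
  [dg 3 7 Colour.R,
   dg 3 1 Colour.R,
   dg 4 1 Colour.R,
   dg 5 1 Colour.P,
   dg 6 1 Colour.P,
   dg 6 2 Colour.P,
   dg 6 3 Colour.R,
   dg 6 4 Colour.R]]

/-- The curves of `(6, 1, 'B')`. -/
def c61 : List (List Dg) :=
  [  [dg 7 2 Colour.B,
   dg 7 3 Colour.B,
   dg 4 7 Colour.P,
   dg 5 7 Colour.P,
   dg 5 1 Colour.P,
   dg 2 5 Colour.B,
   dg 3 5 Colour.B,
   dg 3 6 Colour.B],
  [dg 7 5 Colour.R,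
   dg 7 4 Colour.R,
   dg 7 3 Colour.P,
   dg 7 2 Colour.P,
   dg 6 2 Colour.P,
   dg 5 2 Colour.R,
   dg 4 2 Colour.R,
   dg 4 1 Colour.R]]

/-- The curves `C₁(D), …, C_r(D)` (`r ∈ {2,4}`) attached to each vertex `D`
of the first slice of `Γ`; each curve is the set of diagonals obtained from
`τ^{∓1}(D)` by a prescribed sequence of minimal clockwise (respectively
anticlockwise) rotations around alternating vertices of `Π`. -/
def curvesBase (d : Dg) : List (List Dg) :=
  if d = dg 1 3 Colour.P then c13
  else if d = dg 1 4 Colour.P then c14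
  else if d = dg 1 5 Colour.R then c15
  else if d = dg 1 6 Colour.R then c16
  else if d = dg 5 1 Colour.B then c51
  else if d = dg 6 1 Colour.B then c61
  else []

/-- `Y` lies on the `n`-th curve of `X`: curves of arbitrary vertices of `Γ`
are the `τ`-translates of the curves of the first-slice vertices. -/
def CurveMem (X : Dg) (n : ℕ) (Y : Dg) : Prop :=
  ∃ (k : ℕ) (b : Dg) (C : List Dg) (z : Dg),
    b ∈ firstSlice ∧ tau7^[k] b = X ∧ (curvesBase b)[n]? = some C ∧
      z ∈ C ∧ tau7^[k] z = Y

open Classical in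
/-- `dim_k Ext¹_Π(X, Y)`: the number of curves of `X` on which `Y` lies. -/
noncomputable def extDim (X Y : Dg) : ℕ :=
  ((Finset.range 4).filter fun n => CurveMem X n Y).card

/-- A cluster configuration: six pairwise distinct elements of `Π_{1,2,2}`
with vanishing `Ext¹_Π` between any two of them.  (Under the equivalence of
the mesh category of `Γ^7_{1,2,2}` with `C_{E₆}`, these correspond exactly to
the cluster tilting sets of the cluster category `C_{E₆}`.) -/
def IsConfig (T : Finset Dg) : Prop :=
  T.card = 6 ∧ (∀ d ∈ T, InPi d) ∧ ∀ x ∈ T, ∀ y ∈ T, extDim x y = 0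

/-- `x` lies strictly inside the clockwise arc from `a` to `b`. -/
def inArc (a b x : ZMod 7) : Prop :=
  0 < (x - a).val ∧ (x - a).val < (b - a).val

/-- Two coloured oriented diagonals cross if their underlying chords of `Π`
intersect in an interior point of `Π`. -/
def crosses (a b : Dg) : Prop :=
  (inArc a.i a.j b.i ∧ inArc a.j a.i b.j) ∨
  (inArc a.i a.j b.j ∧ inArc a.j a.i b.i)

/-- Long paired diagonals `[i,i+3]_P`. -/
def IsLongPaired (d : Dg) : Prop := d.c = Colour.P ∧ d.j - d.i = 3

/-- Short paired diagonals `[i,i+2]_P`. -/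
def IsShortPaired (d : Dg) : Prop := d.c = Colour.P ∧ d.j - d.i = 2

/-- `ρ` applied to a whole collection of diagonals. -/
def rhoT (T : Finset Dg) : Finset Dg := T.image rho

/-- `D*` is a complement of `D` in the cluster configuration `T`. -/
def IsComplement (T : Finset Dg) (D D' : Dg) : Prop :=
  D' ≠ D ∧ IsConfig (insert D' (T.erase D))

/-! ### Translation invariance of the extension relation -/

instance : Fintype Colour := ⟨{Colour.R, Colour.B, Colour.P}, fun c => by cases c <;> decide⟩

theorem tau7_iterate_fourteen (d : Dg) : tau7^[14] d = d := by
  obtain ⟨i, j, c⟩ := d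
  revert i j c
  decide +kernel

theorem tau7_iterate_mod (k : ℕ) (d : Dg) : tau7^[k % 14] d = tau7^[k] d :=
  Function.IsPeriodicPt.iterate_mod_apply (f := tau7) (n := 14) (tau7_iterate_fourteen d) k

/-- `Y` lies on some curve of `X`. -/
def Linked (X Y : Dg) : Prop :=
  ∃ k < 14, ∃ b ∈ firstSlice, tau7^[k] b = X ∧ ∃ z ∈ (curvesBase b).flatten, tau7^[k] z = Y

instance (X Y : Dg) : Decidable (Linked X Y) := by unfold Linked; infer_instance

theorem length_curvesBase_le (b : Dg) : (curvesBase b).length ≤ 4 := by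
  unfold curvesBase
  split_ifs <;> decide

theorem linked_iff {X Y : Dg} : Linked X Y ↔ ∃ n < 4, CurveMem X n Y := by
  constructor
  · rintro ⟨k, -, b, hb, hX, z, hz, hY⟩
    obtain ⟨C, hC, hzC⟩ := List.mem_flatten.1 hz
    obtain ⟨n, hn, rfl⟩ := List.mem_iff_getElem.1 hC
    exact ⟨n, hn.trans_le (length_curvesBase_le b), k, b, _, z, hb, hX,
      List.getElem?_eq_getElem hn, hzC, hY⟩
  · rintro ⟨n, -, k, b, C, z, hb, hX, hC, hz, hY⟩
    refine ⟨k % 14, Nat.mod_lt _ (by norm_num), b, hb, ?_, z,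
      List.mem_flatten.2 ⟨C, List.mem_of_getElem? hC, hz⟩, ?_⟩
    · rw [tau7_iterate_mod, hX]
    · rw [tau7_iterate_mod, hY]

theorem extDim_eq_zero_iff {X Y : Dg} : extDim X Y = 0 ↔ ¬ Linked X Y := by
  classical
  rw [linked_iff, extDim, Finset.card_eq_zero, Finset.filter_eq_empty_iff]
  simp only [Finset.mem_range, not_exists, not_and]

theorem Linked.iterate {X Y : Dg} (h : Linked X Y) (m : ℕ) :
    Linked (tau7^[m] X) (tau7^[m] Y) := by
  obtain ⟨k, -, b, hb, rfl, z, hz, rfl⟩ := h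
  refine ⟨(m + k) % 14, Nat.mod_lt _ (by norm_num), b, hb, ?_, z, hz, ?_⟩ <;>
    rw [tau7_iterate_mod, Function.iterate_add_apply]

theorem tau7_iterate_cancel {k : ℕ} (hk : k < 14) (d : Dg) :
    tau7^[14 - k] (tau7^[k] d) = d := by
  rw [← Function.iterate_add_apply, Nat.sub_add_cancel hk.le, tau7_iterate_fourteen]

theorem linked_iterate_iff {X Y : Dg} {k : ℕ} (hk : k < 14) :
    Linked (tau7^[k] X) (tau7^[k] Y) ↔ Linked X Y :=
  ⟨fun h => by simpa only [tau7_iterate_cancel hk] using h.iterate (14 - k), fun h => h.iterate k⟩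

/-! ### The symmetry `ρ` -/

theorem rho_rho (d : Dg) : rho (rho d) = d := by
  obtain ⟨i, j, c⟩ := d
  cases c <;> rfl

theorem rho_injective : Function.Injective rho :=
  Function.LeftInverse.injective rho_rho

theorem rho_eq_self_iff {d : Dg} : rho d = d ↔ d.c = Colour.P := by
  obtain ⟨i, j, c⟩ := d
  cases c <;> simp [rho]

theorem rho_c_eq_iff {d : Dg} : (rho d).c = Colour.P ↔ d.c = Colour.P := by
  obtain ⟨i, j, c⟩ := d
  cases c <;> simp [rho]

theorem rho_eq_tau7_iterate {d : Dg} (hd : InPi d) : rho d = tau7^[7] d := by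
  obtain ⟨i, h⟩ := hd
  revert i
  rintro i (rfl | rfl | rfl | rfl | rfl | rfl) <;> revert i <;> decide +kernel

theorem InPi.rho {d : Dg} (hd : InPi d) : InPi (rho d) := by
  obtain ⟨i, rfl | rfl | rfl | rfl | rfl | rfl⟩ := hd <;> exact ⟨i, by simp [_root_.rho]⟩

theorem extDim_rho {X Y : Dg} (hX : InPi X) (hY : InPi Y) (h : extDim X Y = 0) :
    extDim (rho X) (rho Y) = 0 := by
  rw [extDim_eq_zero_iff] at h ⊢
  rwa [rho_eq_tau7_iterate hX, rho_eq_tau7_iterate hY, linked_iterate_iff (by norm_num)]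

theorem IsConfig.rhoT {T : Finset Dg} (hT : IsConfig T) : IsConfig (rhoT T) := by
  obtain ⟨hcard, hPi, hext⟩ := hT
  refine ⟨(Finset.card_image_of_injective T rho_injective).trans hcard, ?_, ?_⟩
  · simp only [_root_.rhoT, Finset.forall_mem_image]
    exact fun d hd => (hPi d hd).rho
  · simp only [_root_.rhoT, Finset.forall_mem_image]
    exact fun x hx y hy => extDim_rho (hPi x hx) (hPi y hy) (hext x hx y hy)

theorem rhoT_insert (d : Dg) (T : Finset Dg) : rhoT (insert d T) = insert (rho d) (rhoT T) :=
  Finset.image_insert rho d T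

theorem rhoT_erase (d : Dg) (T : Finset Dg) : rhoT (T.erase d) = (rhoT T).erase (rho d) :=
  Finset.image_erase rho_injective T d

/-! ### Coordinates on the translation quiver

The pair `(b, k)` stands for the `k`-th translate of the `b`-th vertex of the first slice; the
orbits of the first four vertices exhaust `Π_{1,2,2}`. -/

/-- The diagonal with coordinates `(b, k)`. -/
def vtx (x : ℕ × ℕ) : Dg := tau7^[x.2] (firstSlice.getD x.1 (dg 1 3 Colour.P))

/-- The coordinates of the paired diagonals. -/
def pairedIdx : List (ℕ × ℕ) := List.range 2 ×ˢ List.range 7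

/-- The coordinates of the single diagonals. -/
def singleIdx : List (ℕ × ℕ) := [2, 3] ×ˢ List.range 14

/-- The action of `ρ` on the coordinates of single diagonals. -/
def rhoIdx (x : ℕ × ℕ) : ℕ × ℕ := (x.1, (x.2 + 7) % 14)

/-- The `m`-th bit of `linkMask b c` tells whether the `m`-th translate of the `c`-th vertex of
the first slice lies on a curve of the `b`-th one. -/
def linkMask (b c : ℕ) : ℕ :=
  ([[11610, 15996, 15480, 10320],
    [7998, 16254, 15996, 15480],
    [3870, 7998, 15934, 11316],
    [1290, 3870, 5658, 9234]] : List (List ℕ)).getD b [] |>.getD c 0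

/-- Vanishing of `Ext` in coordinates. -/
def unlinked (x y : ℕ × ℕ) : Bool :=
  !(linkMask x.1 y.1).testBit ((y.2 + (14 - x.2)) % 14)

theorem linked_vtx_zero_iff : ∀ b < 4, ∀ c < 4, ∀ m < 14,
    (Linked (vtx (b, 0)) (vtx (c, m)) ↔ (linkMask b c).testBit m = true) := by
  decide +kernel

theorem extDim_vtx_eq_zero_iff {x y : ℕ × ℕ} (hx : x.1 < 4) (hx' : x.2 < 14) (hy : y.1 < 4) :
    extDim (vtx x) (vtx y) = 0 ↔ unlinked x y = true := by
  have hm : (y.2 + (14 - x.2)) % 14 < 14 := Nat.mod_lt _ (by norm_num)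
  have hX : vtx x = tau7^[x.2] (vtx (x.1, 0)) := rfl
  have hY : vtx y = tau7^[x.2] (vtx (y.1, (y.2 + (14 - x.2)) % 14)) := by
    simp only [vtx]
    rw [tau7_iterate_mod, ← Function.iterate_add_apply,
      show x.2 + (y.2 + (14 - x.2)) = y.2 + 14 by omega, Function.iterate_add_apply,
      tau7_iterate_fourteen]
  rw [extDim_eq_zero_iff, hX, hY, linked_iterate_iff hx', linked_vtx_zero_iff _ hx _ hy _ hm,
    unlinked]
  simp

theorem bounds_of_mem_pairedIdx {x : ℕ × ℕ} (hx : x ∈ pairedIdx) : x.1 < 4 ∧ x.2 < 14 := by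
  revert x
  decide

theorem bounds_of_mem_singleIdx {x : ℕ × ℕ} (hx : x ∈ singleIdx) : x.1 < 4 ∧ x.2 < 14 := by
  revert x
  decide

theorem rhoIdx_mem_singleIdx {x : ℕ × ℕ} (hx : x ∈ singleIdx) : rhoIdx x ∈ singleIdx := by
  revert x
  decide

theorem rho_vtx {x : ℕ × ℕ} (hx : x ∈ singleIdx) : rho (vtx x) = vtx (rhoIdx x) := by
  revert x
  decide +kernel

theorem InPi.exists_pairedIdx {d : Dg} (hd : InPi d) (hc : d.c = Colour.P) :
    ∃ x ∈ pairedIdx, vtx x = d := by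
  obtain ⟨i, rfl | rfl | rfl | rfl | rfl | rfl⟩ := hd <;>
    first | (cases hc; done) | (revert i; decide +kernel)

theorem InPi.exists_singleIdx {d : Dg} (hd : InPi d) (hc : d.c ≠ Colour.P) :
    ∃ x ∈ singleIdx, vtx x = d := by
  obtain ⟨i, rfl | rfl | rfl | rfl | rfl | rfl⟩ := hd <;>
    first | exact absurd rfl hc | (clear hc; revert i; decide +kernel)

/-! ### Complements in `ρ`-symmetric configurations -/

/-- Let `p, q` be paired and `a, b` single coordinates spanning a `ρ`-symmetric configuration.
The three assertions concern the diagonals that can replace `p`, and those that can replace `a`. -/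
theorem complement_idx : ∀ p ∈ pairedIdx, ∀ q ∈ pairedIdx, unlinked p q → p ≠ q →
    ∀ a ∈ singleIdx, (∀ y ∈ [p, q, rhoIdx a], unlinked y a) →
    ∀ b ∈ singleIdx, (∀ y ∈ [p, q, a, rhoIdx a, rhoIdx b], unlinked y b) → a ≠ b → a ≠ rhoIdx b →
    (∀ x ∈ singleIdx, (∀ y ∈ [q, a, rhoIdx a, b, rhoIdx b], unlinked y x) →
      x ∈ [a, rhoIdx a, b, rhoIdx b]) ∧
    (∀ x ∈ pairedIdx, (∀ y ∈ [p, q, rhoIdx a, b, rhoIdx b], unlinked y x) → x ∈ [p, q]) ∧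
    (∀ x ∈ singleIdx, (∀ y ∈ [p, q, rhoIdx a, b, rhoIdx b], unlinked y x) →
      unlinked x (rhoIdx x)) := by
  decide +kernel

theorem unlinked_of_extDim {x y : ℕ × ℕ} (hx : x ∈ pairedIdx ∨ x ∈ singleIdx)
    (hy : y ∈ pairedIdx ∨ y ∈ singleIdx) (h : extDim (vtx x) (vtx y) = 0) :
    unlinked x y = true := by
  have hx' := hx.elim bounds_of_mem_pairedIdx bounds_of_mem_singleIdx
  have hy' := hy.elim bounds_of_mem_pairedIdx bounds_of_mem_singleIdx
  exact (extDim_vtx_eq_zero_iff hx'.1 hx'.2 hy'.1).1 h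

/-- A `ρ`-symmetric configuration with its elements listed. -/
def IsSymShape (T : Finset Dg) (P₁ P₂ S₁ S₂ : Dg) : Prop :=
  IsConfig T ∧ T = {P₁, P₂, S₁, rho S₁, S₂, rho S₂} ∧
    P₁.c = Colour.P ∧ P₂.c = Colour.P ∧ S₁.c ≠ Colour.P ∧ S₂.c ≠ Colour.P

theorem IsConfig.notMem_of_insert_erase {T : Finset Dg} {D D' : Dg} (hT : IsConfig T) (hD : D ∈ T)
    (h : IsConfig (insert D' (T.erase D))) : D' ∉ T.erase D := by
  intro hmem
  have h₁ := h.1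
  rw [Finset.insert_eq_of_mem hmem, Finset.card_erase_of_mem hD, hT.1] at h₁
  omega

namespace IsSymShape

variable {T : Finset Dg} {P₁ P₂ S₁ S₂ : Dg}

theorem swap_paired (h : IsSymShape T P₁ P₂ S₁ S₂) : IsSymShape T P₂ P₁ S₁ S₂ := by
  obtain ⟨hT, hs, h₁, h₂, h₃, h₄⟩ := h
  exact ⟨hT, hs.trans (Finset.insert_comm _ _ _), h₂, h₁, h₃, h₄⟩

theorem swap_single (h : IsSymShape T P₁ P₂ S₁ S₂) : IsSymShape T P₁ P₂ S₂ S₁ := by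
  obtain ⟨hT, hs, h₁, h₂, h₃, h₄⟩ := h
  refine ⟨hT, hs.trans ?_, h₁, h₂, h₄, h₃⟩
  ext d
  simp only [Finset.mem_insert, Finset.mem_singleton]
  tauto

theorem nodup (h : IsSymShape T P₁ P₂ S₁ S₂) :
    [P₁, P₂, S₁, rho S₁, S₂, rho S₂].Nodup := by
  rw [← Multiset.coe_nodup, ← Multiset.toFinset_card_eq_card_iff_nodup]
  have hcard := h.1.1
  rw [h.2.1] at hcard
  simpa using hcard

theorem subset (h : IsSymShape T P₁ P₂ S₁ S₂) :
    P₁ ∈ T ∧ P₂ ∈ T ∧ S₁ ∈ T ∧ rho S₁ ∈ T ∧ S₂ ∈ T ∧ rho S₂ ∈ T := by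
  rw [h.2.1]
  simp

theorem rhoT_eq (h : IsSymShape T P₁ P₂ S₁ S₂) : rhoT T = T := by
  obtain ⟨-, rfl, h₁, h₂, -, -⟩ := h
  ext d
  simp only [rhoT, Finset.image_insert, Finset.image_singleton, rho_rho, rho_eq_self_iff.2 h₁,
    rho_eq_self_iff.2 h₂, Finset.mem_insert, Finset.mem_singleton]
  tauto

/-- `complement_idx` for diagonals. -/
theorem complement_cases (h : IsSymShape T P₁ P₂ S₁ S₂) {X : Dg} (hX : InPi X) :
    (X.c ≠ Colour.P → (∀ y ∈ [P₂, S₁, rho S₁, S₂, rho S₂], extDim y X = 0) →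
      X ∈ [S₁, rho S₁, S₂, rho S₂]) ∧
    (X.c = Colour.P → (∀ y ∈ [P₁, P₂, rho S₁, S₂, rho S₂], extDim y X = 0) → X ∈ [P₁, P₂]) ∧
    (X.c ≠ Colour.P → (∀ y ∈ [P₁, P₂, rho S₁, S₂, rho S₂], extDim y X = 0) →
      extDim X (rho X) = 0) := by
  have hnd := h.nodup
  obtain ⟨m₁, m₂, m₃, m₄, m₅, m₆⟩ := h.subset
  obtain ⟨⟨-, hPi, hext⟩, -, h₁, h₂, h₃, h₄⟩ := h
  obtain ⟨p, hp, rfl⟩ := (hPi _ m₁).exists_pairedIdx h₁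
  obtain ⟨q, hq, rfl⟩ := (hPi _ m₂).exists_pairedIdx h₂
  obtain ⟨a, ha, rfl⟩ := (hPi _ m₃).exists_singleIdx h₃
  obtain ⟨b, hb, rfl⟩ := (hPi _ m₅).exists_singleIdx h₄
  rw [rho_vtx ha] at m₄ hnd ⊢
  rw [rho_vtx hb] at m₆ hnd ⊢
  have hra := rhoIdx_mem_singleIdx ha
  have hrb := rhoIdx_mem_singleIdx hb
  simp only [List.nodup_cons, List.mem_cons, List.not_mem_nil, or_false, not_or] at hnd
  obtain ⟨⟨n₁₂, -⟩, -, ⟨-, n₃₅, n₃₆⟩, -⟩ := hnd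
  have hu : ∀ {x y}, (x ∈ pairedIdx ∨ x ∈ singleIdx) → (y ∈ pairedIdx ∨ y ∈ singleIdx) →
      vtx x ∈ T → vtx y ∈ T → unlinked x y = true :=
    fun hx hy hxT hyT => unlinked_of_extDim hx hy (hext _ hxT _ hyT)
  obtain ⟨k₁, k₂, k₃⟩ := complement_idx p hp q hq (hu (.inl hp) (.inl hq) m₁ m₂)
    (ne_of_apply_ne vtx n₁₂) a ha (by simp [*]) b hb (by simp [*])
    (ne_of_apply_ne vtx n₃₅) (ne_of_apply_ne vtx n₃₆)
  simp only [List.forall_mem_cons, List.not_mem_nil, false_imp_iff, implies_true, and_true]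
    at k₁ k₂ k₃ ⊢
  refine ⟨?_, ?_, ?_⟩
  · rintro hc ⟨e₁, e₂, e₃, e₄, e₅⟩
    obtain ⟨x, hx, rfl⟩ := hX.exists_singleIdx hc
    exact List.mem_map_of_mem (f := vtx) (k₁ x hx
      ⟨unlinked_of_extDim (.inl hq) (.inr hx) e₁, unlinked_of_extDim (.inr ha) (.inr hx) e₂,
        unlinked_of_extDim (.inr hra) (.inr hx) e₃, unlinked_of_extDim (.inr hb) (.inr hx) e₄,
        unlinked_of_extDim (.inr hrb) (.inr hx) e₅⟩)
  · rintro hc ⟨e₁, e₂, e₃, e₄, e₅⟩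
    obtain ⟨x, hx, rfl⟩ := hX.exists_pairedIdx hc
    exact List.mem_map_of_mem (f := vtx) (k₂ x hx
      ⟨unlinked_of_extDim (.inl hp) (.inl hx) e₁, unlinked_of_extDim (.inl hq) (.inl hx) e₂,
        unlinked_of_extDim (.inr hra) (.inl hx) e₃, unlinked_of_extDim (.inr hb) (.inl hx) e₄,
        unlinked_of_extDim (.inr hrb) (.inl hx) e₅⟩)
  · rintro hc ⟨e₁, e₂, e₃, e₄, e₅⟩
    obtain ⟨x, hx, rfl⟩ := hX.exists_singleIdx hc
    have hrx := rhoIdx_mem_singleIdx hx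
    rw [rho_vtx hx, extDim_vtx_eq_zero_iff (bounds_of_mem_singleIdx hx).1
      (bounds_of_mem_singleIdx hx).2 (bounds_of_mem_singleIdx hrx).1]
    exact k₃ x hx
      ⟨unlinked_of_extDim (.inl hp) (.inr hx) e₁, unlinked_of_extDim (.inl hq) (.inr hx) e₂,
        unlinked_of_extDim (.inr hra) (.inr hx) e₃, unlinked_of_extDim (.inr hb) (.inr hx) e₄,
        unlinked_of_extDim (.inr hrb) (.inr hx) e₅⟩

/-- A complement of `D` is compatible with any list of elements of `T` avoiding `D`. -/
theorem _root_.IsComplement.extDim_eq_zero {D X : Dg} (hX : IsComplement T D X) {l : List Dg}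
    (hl : ∀ y ∈ l, y ∈ T.erase D) : ∀ y ∈ l, extDim y X = 0 := fun y hy =>
  hX.2.2.2 y (Finset.mem_insert_of_mem (hl y hy)) X (Finset.mem_insert_self _ _)

theorem complement_paired (h : IsSymShape T P₁ P₂ S₁ S₂) {X : Dg} (hX : IsComplement T P₁ X) :
    X.c = Colour.P ∧ rhoT (insert X (T.erase P₁)) = insert X (T.erase P₁) := by
  have hXc : X.c = Colour.P := by
    by_contra hXc
    have hmem : ∀ y ∈ [P₂, S₁, rho S₁, S₂, rho S₂], y ∈ T.erase P₁ := by
      intro y hy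
      rw [Finset.mem_erase, h.2.1]
      exact ⟨fun e => (List.nodup_cons.1 h.nodup).1 (e ▸ hy), by
        simpa using List.mem_cons_of_mem P₁ hy⟩
    have hXmem := (h.complement_cases (hX.2.2.1 X (Finset.mem_insert_self _ _))).1 hXc
      (hX.extDim_eq_zero hmem)
    exact h.1.notMem_of_insert_erase h.subset.1 hX.2 (hmem X (List.mem_cons_of_mem _ hXmem))
  refine ⟨hXc, ?_⟩
  rw [rhoT_insert, rhoT_erase, h.rhoT_eq, rho_eq_self_iff.2 hXc, rho_eq_self_iff.2 h.2.2.1]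

theorem complement_single (h : IsSymShape T P₁ P₂ S₁ S₂) {X : Dg} (hX : IsComplement T S₁ X) :
    X.c ≠ Colour.P ∧ IsComplement T (rho S₁) (rho X) ∧
      IsConfig (insert (rho X) (insert X ((T.erase S₁).erase (rho S₁)))) ∧
      rhoT (insert (rho X) (insert X ((T.erase S₁).erase (rho S₁)))) =
        insert (rho X) (insert X ((T.erase S₁).erase (rho S₁))) := by
  have hXPi : InPi X := hX.2.2.1 X (Finset.mem_insert_self _ _)
  have hnot := h.1.notMem_of_insert_erase h.subset.2.2.1 hX.2
  have hcases := h.complement_cases hXPi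
  have hmem : ∀ y ∈ [P₁, P₂, rho S₁, S₂, rho S₂], y ∈ T.erase S₁ := by
    have hnd := h.nodup
    obtain ⟨m₁, m₂, -, m₄, m₅, m₆⟩ := h.subset
    simp only [List.nodup_cons, List.mem_cons, List.not_mem_nil, or_false, not_or] at hnd
    obtain ⟨⟨-, n₁₃, -⟩, ⟨n₂₃, -⟩, ⟨n₃₄, n₃₅, n₃₆⟩, -⟩ := hnd
    simp [*, Ne.symm n₃₄, Ne.symm n₃₅, Ne.symm n₃₆]
  have hXc : X.c ≠ Colour.P := fun hXc => hnot <| hmem X <|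
    List.mem_append_left [rho S₁, S₂, rho S₂] (hcases.2.1 hXc (hX.extDim_eq_zero hmem))
  have hXr : extDim X (rho X) = 0 := hcases.2.2 hXc (hX.extDim_eq_zero hmem)
  have hrX : extDim (rho X) X = 0 := by
    simpa only [rho_rho] using extDim_rho hXPi hXPi.rho hXr
  have hcompl : IsComplement T (rho S₁) (rho X) := by
    refine ⟨rho_injective.ne hX.1, ?_⟩
    have := hX.2.rhoT
    rwa [rhoT_insert, rhoT_erase, h.rhoT_eq] at this
  have hnot' := h.1.notMem_of_insert_erase h.subset.2.2.2.1 hcompl.2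
  have hrS : rho S₁ ∈ T.erase S₁ := hmem _ (by simp)
  refine ⟨hXc, hcompl, ⟨?_, ?_, ?_⟩, ?_⟩
  · rw [Finset.card_insert_of_notMem, Finset.card_insert_of_notMem,
      Finset.card_erase_of_mem hrS, Finset.card_erase_of_mem h.subset.2.2.1, h.1.1]
    · exact fun hmemX => hnot (Finset.mem_of_mem_erase hmemX)
    · rw [Finset.mem_insert, rho_eq_self_iff, Finset.erase_right_comm]
      exact not_or.2 ⟨hXc, fun hmemX => hnot' (Finset.mem_of_mem_erase hmemX)⟩
  · intro d hd
    rcases Finset.mem_insert.1 hd with rfl | hd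
    · exact hXPi.rho
    rcases Finset.mem_insert.1 hd with rfl | hd
    · exact hXPi
    exact h.1.2.1 d (Finset.mem_of_mem_erase (Finset.mem_of_mem_erase hd))
  · have hsub : ∀ d, d = X ∨ d ∈ (T.erase S₁).erase (rho S₁) → d ∈ insert X (T.erase S₁) :=
      fun d hd => Finset.mem_insert.2 (hd.imp_right Finset.mem_of_mem_erase)
    have hsub' : ∀ d, d = rho X ∨ d ∈ (T.erase S₁).erase (rho S₁) →
        d ∈ insert (rho X) (T.erase (rho S₁)) := fun d hd =>
      Finset.mem_insert.2 (hd.imp_right fun hd =>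
        Finset.mem_of_mem_erase (Finset.erase_right_comm (s := T) ▸ hd))
    intro y hy z hz
    simp only [Finset.mem_insert] at hy hz
    rcases hy with rfl | hy
    · rcases hz with rfl | rfl | hz
      · exact hcompl.2.2.2 _ (hsub' _ (.inl rfl)) _ (hsub' _ (.inl rfl))
      · exact hrX
      · exact hcompl.2.2.2 _ (hsub' _ (.inl rfl)) _ (hsub' _ (.inr hz))
    · rcases hz with rfl | hz
      · rcases hy with rfl | hy
        · exact hXr
        · exact hcompl.2.2.2 _ (hsub' _ (.inr hy)) _ (hsub' _ (.inl rfl))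
      · exact hX.2.2.2 _ (hsub _ hy) _ (hsub _ hz)
  · rw [rhoT_insert, rhoT_insert, rhoT_erase, rhoT_erase, h.rhoT_eq, rho_rho, rho_rho,
      Finset.erase_right_comm, Finset.insert_comm]

end IsSymShape

/-- Proposition 6.3.  Let
`T_ρ = {P₁, P₂, S₁, ρ(S₁), S₂, ρ(S₂)}` be a `ρ`-symmetric cluster
configuration of the heptagon `Π`, consisting of two paired diagonals and two
`ρ`-orbits of single diagonals.  Then for `k ∈ {1,2}`, replacing `P_k` by its
(unique) complement `P_k*` yields again a `ρ`-symmetric cluster configuration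
with `P_k*` paired; and for `l ∈ {1,2}`, replacing the `ρ`-orbit
`{S_l, ρ(S_l)}` by `{S_l*, ρ(S_l*)}` yields again a `ρ`-symmetric cluster
configuration, with `S_l*` single and `ρ(S_l)* = ρ(S_l*)`.  In particular,
paired diagonals are exchanged with paired diagonals and single diagonals
with single diagonals. -/
theorem rho_symmetric_mutation (T : Finset Dg) (P₁ P₂ S₁ S₂ : Dg)
    (hT : IsConfig T)
    (hshape : T = {P₁, P₂, S₁, rho S₁, S₂, rho S₂})
    (hP₁ : P₁.c = Colour.P) (hP₂ : P₂.c = Colour.P)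
    (hS₁ : S₁.c ≠ Colour.P) (hS₂ : S₂.c ≠ Colour.P)
    (hsym : rhoT T = T) :
    (∀ Pk : Dg, (Pk = P₁ ∨ Pk = P₂) →
      ∀ Pk' : Dg, IsComplement T Pk Pk' →
        Pk'.c = Colour.P ∧
        IsConfig (insert Pk' (T.erase Pk)) ∧
        rhoT (insert Pk' (T.erase Pk)) = insert Pk' (T.erase Pk)) ∧
    (∀ Sl : Dg, (Sl = S₁ ∨ Sl = S₂) →
      ∀ Sl' : Dg, IsComplement T Sl Sl' →
        Sl'.c ≠ Colour.P ∧
        IsComplement T (rho Sl) (rho Sl') ∧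
        IsConfig (insert (rho Sl') (insert Sl' ((T.erase Sl).erase (rho Sl)))) ∧
        rhoT (insert (rho Sl') (insert Sl' ((T.erase Sl).erase (rho Sl))))
          = insert (rho Sl') (insert Sl' ((T.erase Sl).erase (rho Sl)))) := by
  have h : IsSymShape T P₁ P₂ S₁ S₂ := ⟨hT, hshape, hP₁, hP₂, hS₁, hS₂⟩
  constructor
  · rintro Pk (rfl | rfl) X hX
    · exact ⟨(h.complement_paired hX).1, hX.2, (h.complement_paired hX).2⟩
    · exact ⟨(h.swap_paired.complement_paired hX).1, hX.2, (h.swap_paired.complement_paired hX).2⟩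
  · rintro Sl (rfl | rfl) X hX
    · exact h.complement_single hX
    · exact h.swap_single.complement_single hX
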